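/- arXiv:math/0106016 — 2 statements merged into one kernel-verified Lean document; each statement's English description precedes it below -/
import Mathlib

section
/- For any integers n, N > 1 with N < 2n there exists a constant c(n, N) > 0 such that for every prime l > c(n, N) and any two rings of integers 𝒪 and 𝒪' of finite extensions of ℚ_l, there is no nontrivial abstract (not assumed continuous) group homomorphism φ: Sp_{2n}(𝒪') → GL_N(𝒪). -/
open Matrix

section LocalRing

lemma aux_isIntegral_iff {l : ℕ} [Fact (Nat.Prime l)] {K : Type} [Field K] [Algebra ℚ_[l] K]
    [FiniteDimensional ℚ_[l] K] [Algebra ℤ_[l] K] [IsScalarTower ℤ_[l] ℚ_[l] K] (x : K) :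
    IsIntegral ℤ_[l] x ↔ spectralNorm ℚ_[l] K x ≤ 1 := by
  have halg : IsIntegral ℚ_[l] x := Algebra.IsIntegral.isIntegral x
  have hmon := minpoly.monic halg
  unfold spectralNorm
  have key : spectralValue (minpoly ℚ_[l] x) ≤ 1 ↔ ∀ n, ‖(minpoly ℚ_[l] x).coeff n‖ ≤ 1 := by
    exact spectralValue_le_one_iff hmon
  rw [key]
  constructor
  · intro h n
    rw [minpoly.isIntegrallyClosed_eq_field_fractions' ℚ_[l] h, Polynomial.coeff_map]
    exact PadicInt.norm_le_one _
  · intro h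
    have : minpoly ℚ_[l] x ∈ Polynomial.lifts (algebraMap ℤ_[l] ℚ_[l]) := by
      rw [Polynomial.lifts_iff_coeff_lifts]
      intro n
      exact ⟨⟨_, h n⟩, rfl⟩
    obtain ⟨q, hq, -, hqm⟩ := Polynomial.lifts_and_natDegree_eq_and_monic this hmon
    refine ⟨q, hqm, ?_⟩
    have h2 := minpoly.aeval ℚ_[l] x
    rw [← hq, Polynomial.aeval_map_algebraMap] at h2
    exact h2

lemma aux_isLocalRing (l : ℕ) [Fact (Nat.Prime l)] (K : Type) [Field K] [Algebra ℚ_[l] K]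
    [FiniteDimensional ℚ_[l] K] [Algebra ℤ_[l] K] [IsScalarTower ℤ_[l] ℚ_[l] K] :
    IsLocalRing (integralClosure ℤ_[l] K) := by
  have hmul : ∀ x y : K, spectralNorm ℚ_[l] K (x * y) =
      spectralNorm ℚ_[l] K x * spectralNorm ℚ_[l] K y := fun x y => 
    map_mul (spectralMulAlgNorm ℚ_[l] K) x y
  have hna : IsNonarchimedean (spectralNorm ℚ_[l] K) := isNonarchimedean_spectralNorm
  have hunit : ∀ x : integralClosure ℤ_[l] K, IsUnit x ↔ ¬ spectralNorm ℚ_[l] K (x : K) < 1 := by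
    intro x
    constructor
    · rintro ⟨u, rfl⟩ h
      have h1 : ((u : integralClosure ℤ_[l] K) : K) * ((u⁻¹ : (integralClosure ℤ_[l] K)ˣ) : integralClosure ℤ_[l] K) = 1 := by
        exact_mod_cast congrArg Subtype.val (Units.mul_inv u)
      have h2 := hmul _ _ ▸ congrArg (spectralNorm ℚ_[l] K) h1
      rw [spectralNorm_one] at h2
      have h3 := (aux_isIntegral_iff (l := l) _).1 ((u⁻¹ : (integralClosure ℤ_[l] K)ˣ) : integralClosure ℤ_[l] K).2
      have := spectralNorm_nonneg (K := ℚ_[l]) ((u : integralClosure ℤ_[l] K) : K)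
      nlinarith
    · intro h
      have hx0 : (x : K) ≠ 0 := by
        rintro h0
        rw [h0, spectralNorm_zero] at h
        norm_num at h
      have h1 : spectralNorm ℚ_[l] K (x : K)  * spectralNorm ℚ_[l] K (x : K)⁻¹ = 1 := by
        rw [← hmul, mul_inv_cancel₀ hx0, spectralNorm_one]
      have h2 : IsIntegral ℤ_[l] (x : K)⁻¹ := by
        rw [aux_isIntegral_iff]
        by_contra hc
        push Not at h hc
        nlinarith
      exact IsUnit.of_mul_eq_one (⟨_, h2⟩ : integralClosure ℤ_[l] K) (Subtype.ext (mul_inv_cancel₀ hx0))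
  refine IsLocalRing.of_nonunits_add ?_
  intro a b ha hb
  rw [mem_nonunits_iff, hunit, not_not] at *
  exact lt_of_le_of_lt (hna _ _) (max_lt ha hb)

lemma aux_isUnit (l : ℕ) [Fact (Nat.Prime l)] (K : Type) [Field K] [Algebra ℤ_[l] K] (p : ℕ)
    (hp : p.Coprime l) :
    IsUnit (p : integralClosure ℤ_[l] K) := by
  have h : IsUnit (p : ℤ_[l]) := by
    rw [PadicInt.isUnit_iff]
    rw [PadicInt.norm_natCast_eq_one_iff]
    exact hp.symm
  simpa using h.map (algebraMap ℤ_[l] (integralClosure ℤ_[l] K))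

end LocalRing

section Symp

variable {n : ℕ} {R : Type*} [CommRing R]

/-- the symplectic form -/
def om (x y : Fin n ⊕ Fin n → R) : R := x ⬝ᵥ (J (Fin n) R *ᵥ y)

lemma om_eq (x y : Fin n ⊕ Fin n → R) :
    om x y = ∑ i, (x (Sum.inr i) * y (Sum.inl i) - x (Sum.inl i) * y (Sum.inr i)) := by
  have hy : y = Sum.elim (y ∘ Sum.inl) (y ∘ Sum.inr) := by ext (i | i) <;> rfl
  rw [om, J, hy, fromBlocks_mulVec]
  simp [dotProduct, Fintype.sum_sum_type, Finset.sum_sub_distrib, neg_mulVec]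
  ring

lemma om_add_left (x y z : Fin n ⊕ Fin n → R) : om (x + y) z = om x z + om y z := by
  simp [om, add_dotProduct]
lemma om_add_right (x y z : Fin n ⊕ Fin n → R) : om z (x + y) = om z x + om z y := by
  simp [om, mulVec_add, dotProduct_add]
lemma om_sub_left (x y z : Fin n ⊕ Fin n → R) : om (x - y) z = om x z - om y z := by
  simp [om, sub_dotProduct]
lemma om_sub_right (x y z : Fin n ⊕ Fin n → R) : om z (x - y) = om z x - om z y := by
  simp [om, mulVec_sub, dotProduct_sub]
lemma om_neg_left (x z : Fin n ⊕ Fin n → R) : om (-x) z = - om x z := by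
  simp [om]
lemma om_neg_right (x z : Fin n ⊕ Fin n → R) : om z (-x) = - om z x := by
  simp [om, mulVec_neg]
lemma om_smul_left (c : R) (x z : Fin n ⊕ Fin n → R) : om (c • x) z = c * om x z := by
  simp [om]
lemma om_smul_right (c : R) (x z : Fin n ⊕ Fin n → R) : om z (c • x) = c * om z x := by
  simp [om, mulVec_smul]
lemma om_self (x : Fin n ⊕ Fin n → R) : om x x = 0 := by
  rw [om_eq]; exact Finset.sum_eq_zero fun i _ => by ring
lemma om_swap (x y : Fin n ⊕ Fin n → R) : om x y = - om y x := by
  rw [om_eq, om_eq, ← Finset.sum_neg_distrib]; exact Finset.sum_congr rfl fun i _ => by ring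

/-- basis vectors -/
def be (i : Fin n) : Fin n ⊕ Fin n → R := Pi.single (Sum.inl i) 1
def bf (i : Fin n) : Fin n ⊕ Fin n → R := Pi.single (Sum.inr i) 1

lemma om_be (x : Fin n ⊕ Fin n → R) (i : Fin n) : om x (be i) = x (Sum.inr i) := by
  rw [om_eq, Finset.sum_eq_single i]
  · simp [be]
  · intro j _ hj; simp [be, hj]
  · simp
lemma om_bf (x : Fin n ⊕ Fin n → R) (i : Fin n) : om x (bf i) = -x (Sum.inl i) := by
  rw [om_eq, Finset.sum_eq_single i]
  · simp [bf]
  · intro j _ hj; simp [bf, hj]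
  · simp

lemma ext_om {x y : Fin n ⊕ Fin n → R} (h : ∀ z, om x z = om y z) : x = y := by
  ext (i | i)
  · simpa [om_bf] using h (bf i)
  · simpa [om_be] using h (be i)

lemma om_mulVec (A : Matrix (Fin n ⊕ Fin n) (Fin n ⊕ Fin n) R) (x y : Fin n ⊕ Fin n → R) :
    om (A *ᵥ x) (A *ᵥ y) = x ⬝ᵥ ((Aᵀ * J (Fin n) R * A) *ᵥ y) := by
  rw [om, ← vecMul_transpose, ← mulVec_mulVec, ← mulVec_mulVec, dotProduct_mulVec x]
  
lemma mem_symp_iff (A : Matrix (Fin n ⊕ Fin n) (Fin n ⊕ Fin n) R) :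
    A ∈ symplecticGroup (Fin n) R ↔ ∀ x y, om (A *ᵥ x) (A *ᵥ y) = om x y := by
  rw [SymplecticGroup.mem_iff']
  constructor
  · intro h x y
    rw [om_mulVec, h, om]
  · intro h
    ext i j
    have := h (Pi.single i 1) (Pi.single j 1)
    rw [om_mulVec, om] at this
    simpa using this

abbrev Sp (n : ℕ) (R : Type*) [CommRing R] := symplecticGroup (Fin n) R

/-- action on vectors -/
def ac (g : Sp n R) (x : Fin n ⊕ Fin n → R) : Fin n ⊕ Fin n → R := g.1 *ᵥ x

lemma ac_mul (g h : Sp n R) (x) : ac (g * h) x = ac g (ac h x) := by simp [ac]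
lemma ac_one (x) : ac (1 : Sp n R) x = x := by simp [ac]
lemma ac_add (g : Sp n R) (x y) : ac g (x + y) = ac g x + ac g y := by simp [ac, mulVec_add]
lemma ac_sub (g : Sp n R) (x y) : ac g (x - y) = ac g x - ac g y := by simp [ac, mulVec_sub]
lemma ac_neg (g : Sp n R) (x) : ac g (-x) = - ac g x := by simp [ac, mulVec_neg]
lemma ac_smul (g : Sp n R) (c : R) (x) : ac g (c • x) = c • ac g x := by simp [ac, mulVec_smul]
lemma ac_inv (g : Sp n R) (x) : ac g⁻¹ (ac g x) = x := by rw [← ac_mul]; simp [ac_one]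
lemma ac_inv' (g : Sp n R) (x) : ac g (ac g⁻¹ x) = x := by rw [← ac_mul]; simp [ac_one]
lemma om_ac (g : Sp n R) (x y) : om (ac g x) (ac g y) = om x y := (mem_symp_iff g.1).1 g.2 x y
lemma ac_ext {g h : Sp n R} (H : ∀ x, ac g x = ac h x) : g = h := by
  apply Subtype.ext
  apply Matrix.ext_of_mulVec_single
  intro i; exact H _
lemma ac_ext_basis {g h : Sp n R} (H : ∀ i, ac g (be i) = ac h (be i))
    (H' : ∀ i, ac g (bf i) = ac h (bf i)) : g = h := by
  apply Subtype.ext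
  apply Matrix.ext_of_mulVec_single
  rintro (i | i)
  · exact H i
  · exact H' i

/-- transvection -/
def tv (v : Fin n ⊕ Fin n → R) (a : R) : Sp n R :=
  ⟨1 + a • vecMulVec v (v ᵥ* J (Fin n) R), by
    have key : ∀ x, (1 + a • vecMulVec v (v ᵥ* J (Fin n) R)) *ᵥ x = x + (a * om v x) • v := by
      intro x
      rw [add_mulVec, one_mulVec, smul_mulVec, vecMulVec_mulVec, om, dotProduct_mulVec]
      ext i; simp; ring
    rw [mem_symp_iff]
    intro x y
    rw [key, key]
    simp only [om_add_left, om_add_right, om_smul_left, om_smul_right, om_self]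
    rw [om_swap x v]; ring⟩

lemma ac_tv (v : Fin n ⊕ Fin n → R) (a : R) (x) : ac (tv v a) x = x + (a * om v x) • v := by
  unfold ac tv
  rw [add_mulVec, one_mulVec, smul_mulVec, vecMulVec_mulVec, om, dotProduct_mulVec]
  ext i; simp; ring

lemma tv_add (v : Fin n ⊕ Fin n → R) (a b : R) : tv v (a + b) = tv v a * tv v b := by
  apply ac_ext; intro x
  simp only [ac_mul, ac_tv, om_add_right, om_smul_right, om_self]
  module

lemma tv_smul (v : Fin n ⊕ Fin n → R) (a c : R) : tv (c • v) a = tv v (c ^ 2 * a) := by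
  apply ac_ext; intro x
  simp only [ac_tv, om_smul_left]
  module

lemma tv_neg (v : Fin n ⊕ Fin n → R) (a : R) : tv (-v) a = tv v a := by
  apply ac_ext; intro x
  simp only [ac_tv, om_neg_left]
  module

lemma tv_conj (g : Sp n R) (v : Fin n ⊕ Fin n → R) (a : R) : tv (ac g v) a = g * tv v a * g⁻¹ := by
  apply ac_ext; intro x
  simp only [ac_tv, ac_mul, ac_add, ac_inv', ac_smul]
  have h := om_ac g v (ac g⁻¹ x)
  rw [ac_inv'] at h
  rw [h]

/-- has a unit coordinate -/
def unim (v : Fin n ⊕ Fin n → R) : Prop := ∃ i, IsUnit (v i)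

def supp (P : Finset (Fin n)) (v : Fin n ⊕ Fin n → R) : Prop :=
  ∀ i ∉ P, v (Sum.inl i) = 0 ∧ v (Sum.inr i) = 0

lemma supp_add {P : Finset (Fin n)} {v w : Fin n ⊕ Fin n → R} (hv : supp P v) (hw : supp P w) :
    supp P (v + w) := fun i hi => by simp [hv i hi, hw i hi]
lemma supp_sub {P : Finset (Fin n)} {v w : Fin n ⊕ Fin n → R} (hv : supp P v) (hw : supp P w) :
    supp P (v - w) := fun i hi => by simp [hv i hi, hw i hi]
lemma supp_be {P : Finset (Fin n)} {i : Fin n} (hi : i ∈ P) : supp P (be i : _ → R) := by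
  intro j hj
  have : j ≠ i := fun h => hj (h ▸ hi)
  simp [be, this]
lemma supp_bf {P : Finset (Fin n)} {i : Fin n} (hi : i ∈ P) : supp P (bf i : _ → R) := by
  intro j hj
  have : j ≠ i := fun h => hj (h ▸ hi)
  simp [bf, this]

/-- allowed transvections -/
def TT (P : Finset (Fin n)) : Subgroup (Sp n R) :=
  Subgroup.closure {g | ∃ v a, unim v ∧ supp P v ∧ g = tv v a}

lemma TT_mono {P Q : Finset (Fin n)} (h : P ⊆ Q) : (TT P : Subgroup (Sp n R)) ≤ TT Q := by
  apply Subgroup.closure_mono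
  rintro g ⟨v, a, hv, hs, rfl⟩
  exact ⟨v, a, hv, fun i hi => hs i (fun h' => hi (h h')), rfl⟩

lemma TT_fix {P : Finset (Fin n)} {g : Sp n R} (hg : g ∈ TT P) {j : Fin n} (hj : j ∉ P) :
    ac g (be j) = be j ∧ ac g (bf j) = bf j := by
  induction hg using Subgroup.closure_induction with
  | mem x hx =>
    obtain ⟨v, a, hv, hs, rfl⟩ := hx
    simp [ac_tv, om_be, om_bf, hs j hj]
  | one => simp [ac_one]
  | mul x y _ _ hx hy => simp [ac_mul, hx, hy]
  | inv x _ hx =>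
    constructor
    · nth_rw 1 [← hx.1]; rw [ac_inv]
    · nth_rw 1 [← hx.2]; rw [ac_inv]

variable [IsLocalRing R]

lemma isUnit_add_of {a b : R} (ha : IsUnit a) (hb : ¬ IsUnit b) : IsUnit (a + b) := by
  by_contra h
  have h1 : a + b ∈ nonunits R := h
  have h2 : -b ∈ nonunits R := by simpa using hb
  have := IsLocalRing.nonunits_add h1 h2
  apply this
  simpa using ha

lemma unim_of_om {x y : Fin n ⊕ Fin n → R} (h : IsUnit (om x y)) : unim x := by
  by_contra hc
  unfold unim at hc
  push Not at hc
  have hm : ∀ i, x i ∈ IsLocalRing.maximalIdeal R := fun i => hc i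
  have : om x y ∈ IsLocalRing.maximalIdeal R := by
    rw [om_eq]
    refine Ideal.sum_mem _ fun i _ => Ideal.sub_mem _ ?_ ?_
    · exact Ideal.mul_mem_right _ _ (hm _)
    · exact Ideal.mul_mem_right _ _ (hm _)
  exact this h

/-- direct move -/
lemma move1 {P : Finset (Fin n)} {u v : Fin n ⊕ Fin n → R} (hu : supp P u) (hv : supp P v)
    (h : IsUnit (om u v)) : ∃ a : R, tv (v - u) a ∈ TT P ∧ ac (tv (v - u) a) u = v := by
  obtain ⟨c, hc⟩ := h
  have h1 : om v u = -c := by rw [om_swap, hc]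
  refine ⟨-(c⁻¹ : Rˣ), Subgroup.subset_closure ⟨_, _, ?_, supp_sub hv hu, rfl⟩, ?_⟩
  · apply unim_of_om (y := u)
    rw [om_sub_left, om_self, h1, sub_zero]
    exact c.isUnit.neg
  · rw [ac_tv, om_sub_left, om_self, h1]
    simp

lemma move {P : Finset (Fin n)} {i : Fin n} (hi : i ∈ P) {u : Fin n ⊕ Fin n → R} (hu : supp P u)
    (h : unim u) : ∃ g ∈ TT P, ac g u = be i := by
  have hei : supp P (be i : _ → R) := supp_be hi
  have hfi : supp P (bf i : _ → R) := supp_bf hi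
  have hfe : IsUnit (om (bf i) (be i : _ → R)) := by simp [om_be, bf]
  by_cases h1 : IsUnit (om u (be i))
  · obtain ⟨a, ha, ha'⟩ := move1 hu hei h1
    exact ⟨_, ha, ha'⟩
  obtain ⟨w, hw, hw1, hw2⟩ : ∃ w, supp P w ∧ IsUnit (om u w) ∧ IsUnit (om w (be i)) := by
    by_cases h2 : IsUnit (om u (bf i))
    · exact ⟨_, hfi, h2, hfe⟩
    obtain ⟨j | j, hj⟩ := h
    · have hjP : j ∈ P := by
        by_contra hc
        rw [(hu j hc).1] at hj
        exact not_isUnit_zero hj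
      refine ⟨bf j + bf i, supp_add (supp_bf hjP) hfi, ?_, ?_⟩
      · rw [om_add_right]
        apply isUnit_add_of _ h2
        rw [om_bf]; exact hj.neg
      · have hij : j ≠ i := by
          rintro rfl
          apply h2; rw [om_bf]; exact hj.neg
        simp [om_be, bf, hij.symm]
    · have hjP : j ∈ P := by
        by_contra hc
        rw [(hu j hc).2] at hj
        exact not_isUnit_zero hj
      refine ⟨be j + bf i, supp_add (supp_be hjP) hfi, ?_, ?_⟩
      · rw [om_add_right]
        apply isUnit_add_of _ h2
        rw [om_be]; exact hj
      · rw [om_add_left, om_be, om_be]; simp [bf, be]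
  obtain ⟨a, ha, ha'⟩ := move1 hu hw hw1
  obtain ⟨b, hb, hb'⟩ := move1 hw hei hw2
  exact ⟨_, mul_mem hb ha, by rw [ac_mul, ha', hb']⟩

lemma move2 {P : Finset (Fin n)} {i : Fin n} (hi : i ∈ P) {u : Fin n ⊕ Fin n → R} (hu : supp P u)
    (h : om u (be i) = 1) : ∃ g ∈ TT P, ac g u = bf i ∧ ac g (be i) = be i := by
  have hei : supp P (be i : _ → R) := supp_be hi
  have hfi : supp P (bf i : _ → R) := supp_bf hi
  have hfe : om (bf i) (be i : _ → R) = 1 := by simp [om_be, bf]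
  have fix : ∀ (v w : Fin n ⊕ Fin n → R) (a : R), om v (be i) = 1 → om w (be i) = 1 →
      ac (tv (v - w) a) (be i) = be i := by
    intro v w a hv hw
    simp [ac_tv, om_sub_left, hv, hw]
  by_cases h1 : IsUnit (om u (bf i))
  · obtain ⟨a, ha, ha'⟩ := move1 hu hfi h1
    exact ⟨_, ha, ha', fix _ _ _ hfe h⟩
  have hw : om (u + be i) (be i) = 1 := by simp [om_add_left, h, om_self]
  obtain ⟨a, ha, ha'⟩ := move1 hu (supp_add hu hei) (by simp [om_add_right, om_self, h])
  obtain ⟨b, hb, hb'⟩ := move1 (supp_add hu hei) hfi (by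
    rw [om_add_left, add_comm]
    apply isUnit_add_of _ h1
    simp [om_bf, be])
  exact ⟨_, mul_mem hb ha, by rw [ac_mul, ha', hb'], by 
    rw [ac_mul, fix _ _ _ hw h, fix _ _ _ hfe hw]⟩

lemma generate (P : Finset (Fin n)) : ∀ (g : Sp n R),
    (∀ j ∉ P, ac g (be j) = be j ∧ ac g (bf j) = bf j) → g ∈ TT P := by
  induction P using Finset.induction_on with
  | empty =>
    intro g hg
    have : g = 1 := ac_ext_basis (fun i => by simp [hg i, ac_one]) (fun i => by simp [hg i, ac_one])
    rw [this]; exact one_mem _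
  | insert i P hi ih =>
    intro g hg
    have hiP : i ∈ insert i P := Finset.mem_insert_self _ _
    have hsupp : ∀ g : Sp n R, (∀ j ∉ insert i P, ac g (be j) = be j ∧ ac g (bf j) = bf j) →
        ∀ x, supp (insert i P) x → supp (insert i P) (ac g x) := by
      intro g hg x hx j hj
      have h1 := om_ac g x (be j)
      have h2 := om_ac g x (bf j)
      rw [(hg j hj).1, om_be, om_be, (hx j hj).2] at h1
      rw [(hg j hj).2, om_bf, om_bf, (hx j hj).1, neg_inj] at h2
      exact ⟨h2, h1⟩
    obtain ⟨g1, hg1, hg1'⟩ := move hiP (hsupp g hg _ (supp_be hiP)) (by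
      apply unim_of_om (y := ac g (bf i))
      rw [om_ac]; simp [om_bf, be])
    have hg2 : ∀ j ∉ insert i P, ac (g1 * g) (be j) = be j ∧ ac (g1 * g) (bf j) = bf j := by
      intro j hj
      simp [ac_mul, hg j hj, TT_fix hg1 hj]
    obtain ⟨g2, hg2, hg2', hg2''⟩ := move2 hiP (hsupp _ hg2 _ (supp_bf hiP)) (by
      nth_rw 1 [← hg1']
      rw [← ac_mul, om_ac]; simp [om_be, bf])
    have h3 : g2 * (g1 * g) ∈ TT P := by
      apply ih
      intro j hj
      by_cases hji : j = i
      · subst hji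
        refine ⟨?_, ?_⟩
        · rw [ac_mul, ac_mul, hg1', hg2'']
        · rw [ac_mul, hg2']
      · have hj' : j ∉ insert i P := by simp [hji, hj]
        simp [ac_mul, hg j hj', TT_fix hg1 hj', TT_fix hg2 hj']
    have h4 := TT_mono (Finset.subset_insert i P) h3
    have : g = g1⁻¹ * (g2⁻¹ * (g2 * (g1 * g))) := by group
    rw [this]
    exact mul_mem (inv_mem hg1) (mul_mem (inv_mem hg2) h4)

/-- normal-closure lemma -/
lemma kernel_top {M : Type*} [Group M] (φ : Sp n R →* M) (h2 : IsUnit (2 : R)) (h3 : IsUnit (3 : R))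
    {i j : Fin n} (hij : i ≠ j) (d : Sp n R) (hd : φ d = 1) (hdi : ac d (be i) = - be i)
    (hdj : ac d (be j) = be j) : φ = 1 := by
  let r : (Fin n ⊕ Fin n → R) → (Fin n ⊕ Fin n → R) → Prop := fun v w => ∀ a, φ (tv v a) = φ (tv w a)
  have r_symm : ∀ {v w}, r v w → r w v := fun h a => (h a).symm
  have r_trans : ∀ {u v w}, r u v → r v w → r u w := fun h h' a => (h a).trans (h' a)
  have r_ac : ∀ (g : Sp n R) {v w}, r v w → r (ac g v) (ac g w) := by
    intro g v w h a
    simp only [tv_conj, map_mul, h a]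
  have r_smul : ∀ (c : R) {v w}, r v w → r (c • v) (c • w) := by
    intro c v w h a
    simp only [tv_smul, h _]
  have r_d : ∀ v, r v (ac d v) := by
    intro v a
    simp only [tv_conj, map_mul, hd, map_inv]
    simp
  have r_neg : ∀ v, r v (-v) := fun v a => by rw [tv_neg]
  obtain ⟨c2, hc2⟩ := h2
  have hhalf : (2 : R) * (c2⁻¹ : Rˣ) = 1 := by rw [← hc2]; simp
  set t : R := ((c2⁻¹ : Rˣ) : R) with ht
  -- short root elements
  have short : ∀ (p q : Fin n), p ≠ q → ∀ b : R, ∃ g : Sp n R, ac g (be p) = be p ∧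
      ac g (be q) = be q + b • be p := by
    intro p q hpq b
    have e1 : ∀ x y : Fin n, om (be x : _ → R) (be y) = 0 := fun x y => by rw [om_be]; simp [be]
    have e2 : om (bf q : _ → R) (be q) = 1 := by simp [om_be, bf]
    have e3 : om (bf q : _ → R) (be p) = 0 := by simp [om_be, bf, hpq]
    refine ⟨tv (be p + bf q) (t * b) * tv (be p - bf q) (-(t * b)), ?_, ?_⟩
    · simp [ac_mul, ac_tv, om_add_left, om_sub_left, e1, e3]
    · simp only [ac_mul, ac_tv, om_add_left, om_sub_left, om_add_right, om_smul_right,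
        om_sub_right, e1, e2, e3, om_self, om_swap (be p) (bf q)]
      have : b = 2 * t * b := by rw [hhalf, one_mul]
      conv_rhs => rw [this]
      simp
      module
  have ra : ∀ b : R, r (be j + b • be i) (be j) := by
    intro b
    obtain ⟨g, hg1, hg2⟩ := short i j hij (t * b)
    have h := r_ac g (r_d (be j + (t * b) • be i))
    simp only [ac_add, ac_smul, hdi, hdj, hg1, hg2, ac_neg] at h
    convert h using 1
    · have : b = 2 * t * b := by rw [hhalf, one_mul]
      nth_rw 1 [this]; module
    · module
  have rb : ∀ b : R, r (be i + b • be j) (be i) := by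
    intro b
    obtain ⟨g, hg1, hg2⟩ := short j i hij.symm (t * b)
    have h := r_ac g (r_trans (r_d (be i + (t * b) • be j)) (r_neg _))
    simp only [ac_add, ac_smul, hdi, hdj, hg1, hg2, ac_neg] at h
    convert h using 1
    · have : b = 2 * t * b := by rw [hhalf, one_mul]
      nth_rw 1 [this]; module
    · module
  have r1 : r (be j) (be i) := by
    have h1 := ra 1
    have h2 := rb 1
    rw [one_smul] at h1 h2
    rw [add_comm] at h2
    exact r_trans (r_symm h1) h2
  have r2 : r ((2 : R) • be i) (be j) := by
    have h1 := r_smul 2 (rb t)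
    rw [smul_add, smul_smul, hhalf, one_smul, add_comm] at h1
    exact r_trans (r_symm h1) (ra 2)
  have r3 : r ((2 : R) • be i) (be i) := r_trans r2 r1
  have hT : ∀ a, φ (tv (be i) a) = 1 := by
    intro a
    obtain ⟨c3, hc3⟩ := h3
    have h := r3 ((c3⁻¹ : Rˣ) * a)
    rw [tv_smul] at h
    have e : (2 : R) ^ 2 * ((c3⁻¹ : Rˣ) * a) = a + (c3⁻¹ : Rˣ) * a := by
      have : (3 : R) * (c3⁻¹ : Rˣ) = 1 := by rw [← hc3]; simp
      linear_combination a * this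
    rw [e, tv_add, map_mul] at h
    simpa using h
  ext g
  have hg : g ∈ TT Finset.univ := generate Finset.univ g (by simp)
  suffices (TT Finset.univ : Subgroup (Sp n R)) ≤ φ.ker from this hg
  unfold TT
  rw [Subgroup.closure_le]
  rintro x ⟨v, a, hv, hs, rfl⟩
  obtain ⟨g, -, hg⟩ := move (Finset.mem_univ i) hs hv
  have hv : v = ac g⁻¹ (be i) := by rw [← hg, ac_inv]
  show φ _ = 1
  rw [hv, tv_conj]
  simp [hT]

end Symp

section Rep

open Matrix.SpecialLinearGroup

/-- `-1` dies in abelian images of `SL₂`. -/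
lemma sl2_comm {R M : Type*} [CommRing R] [Monoid M] (h2 : IsUnit (2 : R)) (h3 : IsUnit (3 : R))
    (f : SpecialLinearGroup (Fin 2) R →* M) (hf : ∀ a b, f a * f b = f b * f a) : f (-1) = 1 := by
  obtain ⟨c2, hc2⟩ := h2
  obtain ⟨c3, hc3⟩ := h3
  have e2 : (2 : R) * (c2⁻¹ : Rˣ) = 1 := by rw [← hc2]; simp
  have e3 : (3 : R) * (c3⁻¹ : Rˣ) = 1 := by rw [← hc3]; simp
  set t : R := ((c2⁻¹ : Rˣ) : R)
  set s : R := ((c3⁻¹ : Rˣ) : R)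
  let x : R → SpecialLinearGroup (Fin 2) R := fun b => ⟨!![1, b; 0, 1], by simp⟩
  let y : R → SpecialLinearGroup (Fin 2) R := fun b => ⟨!![1, 0; b, 1], by simp⟩
  let h : SpecialLinearGroup (Fin 2) R := ⟨!![2, 0; 0, t], by simp [e2]⟩
  have comm : ∀ g k : SpecialLinearGroup (Fin 2) R, f (g * k * g⁻¹ * k⁻¹) = 1 := by
    intro g k
    rw [mul_assoc, mul_assoc, map_mul, hf, ← map_mul]
    have : k * (g⁻¹ * k⁻¹) * g = k * (g⁻¹ * k⁻¹ * g) := by group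
    rw [this, map_mul, map_mul, hf, ← map_mul, ← map_mul]
    have : k * (g * (g⁻¹ * k⁻¹)) = 1 := by group
    rw [this, map_one]
  have fx : ∀ b, f (x b) = 1 := by
    intro b
    have : x b = h * x (s * b) * h⁻¹ * (x (s * b))⁻¹ := by
      rw [eq_mul_inv_iff_mul_eq, eq_mul_inv_iff_mul_eq]
      apply Subtype.ext
      show !![1, b; 0, 1] * !![1, s * b; 0, 1] * !![2, 0; 0, t] = !![2, 0; 0, t] * !![1, s * b; 0, 1]
      ext i j
      fin_cases i <;> fin_cases j <;> simp
      linear_combination (-b * t) * e3 + 2 * s * b * e2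
    rw [this, comm]
  have fy : ∀ b, f (y b) = 1 := by
    intro b
    have : y b = h⁻¹ * y (s * b) * h * (y (s * b))⁻¹ := by
      rw [eq_mul_inv_iff_mul_eq, mul_assoc, eq_inv_mul_iff_mul_eq]
      apply Subtype.ext
      show !![2, 0; 0, t] * (!![1, 0; b, 1] * !![1, 0; s * b, 1]) = !![1, 0; s * b, 1] * !![2, 0; 0, t]
      ext i j
      fin_cases i <;> fin_cases j <;> simp
      linear_combination (-b * t) * e3 + 2 * s * b * e2
    rw [this]
    simpa using comm h⁻¹ (y (s * b))
  have : (-1 : SpecialLinearGroup (Fin 2) R) =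
      x 1 * y (-1) * x 1 * (x 1 * y (-1) * x 1) := by
    apply Subtype.ext
    show (-1 : Matrix (Fin 2) (Fin 2) R) = !![1, 1; 0, 1] * !![1, 0; -1, 1] * !![1, 1; 0, 1] *
      (!![1, 1; 0, 1] * !![1, 0; -1, 1] * !![1, 1; 0, 1])
    ext i j
    fin_cases i <;> fin_cases j <;> simp
  rw [this]
  simp [fx, fy]

/-- centralizer in `2 × 2` matrices -/
lemma two_by_two {K : Type*} [Field K] (A B C D : Matrix (Fin 2) (Fin 2) K) (h : A * B ≠ B * A)
    (hC : A * C = C * A) (hD : A * D = D * A) : C * D = D * C := by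
  have c00 := congrFun (congrFun hC 0) 0
  have c01 := congrFun (congrFun hC 0) 1
  have c10 := congrFun (congrFun hC 1) 0
  have d00 := congrFun (congrFun hD 0) 0
  have d01 := congrFun (congrFun hD 0) 1
  have d10 := congrFun (congrFun hD 1) 0
  simp only [Matrix.mul_apply, Fin.sum_univ_two] at c00 c01 c10 d00 d01 d10
  have hA : A 0 1 ≠ 0 ∨ A 1 0 ≠ 0 ∨ A 0 0 - A 1 1 ≠ 0 := by
    by_contra hc
    push Not at hc
    apply h
    obtain ⟨h1, h2, h3⟩ := hc
    have h3 : A 0 0 = A 1 1 := sub_eq_zero.1 h3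
    ext i j
    fin_cases i <;> fin_cases j <;> simp [Matrix.mul_apply, Fin.sum_univ_two, h1, h2, h3] <;> ring
  have k1 : C 0 1 * D 1 0 = D 0 1 * C 1 0 := by
    rcases hA with hA | hA | hA <;> apply mul_left_cancel₀ hA <;> grind
  have k2 : C 0 1 * (D 0 0 - D 1 1) = D 0 1 * (C 0 0 - C 1 1) := by
    rcases hA with hA | hA | hA <;> apply mul_left_cancel₀ hA <;> grind
  have k3 : C 1 0 * (D 0 0 - D 1 1) = D 1 0 * (C 0 0 - C 1 1) := by
    rcases hA with hA | hA | hA <;> apply mul_left_cancel₀ hA <;> grind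
  ext i j
  fin_cases i <;> fin_cases j <;> simp [Matrix.mul_apply, Fin.sum_univ_two]
  · linear_combination k1
  · linear_combination -k2
  · linear_combination k3
  · linear_combination -k1

lemma two_by_two' {K W : Type*} [Field K] [AddCommGroup W] [Module K W] [FiniteDimensional K W]
    (hW : Module.finrank K W = 2) (A B C D : Module.End K W) (h : A * B ≠ B * A)
    (hC : A * C = C * A) (hD : A * D = D * A) : C * D = D * C := by
  let e := LinearMap.toMatrixAlgEquiv (Module.finBasisOfFinrankEq K W hW)
  apply e.injective
  rw [map_mul, map_mul]
  apply two_by_two (e A) (e B)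
  · rw [← map_mul, ← map_mul]; exact fun h' => h (e.injective h')
  · rw [← map_mul, ← map_mul, hC]
  · rw [← map_mul, ← map_mul, hD]

/-- restriction of a representation to an invariant subspace -/
def resRep {G K V : Type*} [Monoid G] [Field K] [AddCommGroup V] [Module K V]
    (ρ : G →* Module.End K V) (W : Submodule K V) (hW : ∀ g, ∀ v ∈ W, ρ g v ∈ W) :
    G →* Module.End K W where
  toFun g := (ρ g).restrict (hW g)
  map_one' := by ext; simp
  map_mul' a b := by ext; simp

variable {n : ℕ} {R : Type*} [CommRing R] {K V : Type*} [Field K] [AddCommGroup V] [Module K V]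


local notation "Γ" => (Fin n → SpecialLinearGroup (Fin 2) R)

/-- the involutions -/
def inv1 (i : Fin n) : Γ := Pi.mulSingle i (-1)

lemma inv1_comm (i : Fin n) (g : Γ) : (inv1 i : Γ) * g = g * inv1 i := by
  funext j
  by_cases h : j = i
  · subst h; simp [inv1]
  · simp [inv1, h]

lemma inv1_sq (i : Fin n) : (inv1 i : Γ) * inv1 i = 1 := by
  simp [inv1, ← Pi.mulSingle_mul]

lemma even_finrank [FiniteDimensional K V] (h2 : IsUnit (2 : R)) (h3 : IsUnit (3 : R)) (hK : (2 : K) ≠ 0)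
    (ρ : Γ →* Module.End K V) (W : Submodule K V) (hW : ∀ g, ∀ v ∈ W, ρ g v ∈ W) (i : Fin n)
    (hi : ∀ v ∈ W, ρ (inv1 i) v = -v) : Even (Module.finrank K W) := by
  let f : SpecialLinearGroup (Fin 2) R →* K := (LinearMap.det (M := W) (A := K)).comp
    ((resRep ρ W hW).comp (MonoidHom.mulSingle (fun _ : Fin n => SpecialLinearGroup (Fin 2) R) i))
  have h := sl2_comm h2 h3 f (fun a b => mul_comm _ _)
  have h' : resRep ρ W hW (inv1 i) = (-1 : K) • LinearMap.id := by
    ext v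
    simp [resRep, hi v.1 v.2]
  have h'' : f (-1) = LinearMap.det (resRep ρ W hW (inv1 i)) := rfl
  rw [h'', h', LinearMap.det_smul, LinearMap.det_id, mul_one] at h
  by_contra hc
  rw [Nat.not_even_iff_odd] at hc
  rw [hc.neg_one_pow] at h
  apply hK
  linear_combination -h

lemma exists_joint (D : Fin n → Module.End K V) (hc : ∀ i j v, D i (D j v) = D j (D i v))
    (hs : ∀ i v, D i (D i v) = v) (a b : Fin n) (s : Finset (Fin n)) :
    ∀ w : V, w ≠ 0 → D a w = - D b w → ∃ w', w' ≠ 0 ∧ D a w' = - D b w' ∧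
      ∀ i ∈ s, D i w' = w' ∨ D i w' = - w' := by
  induction s using Finset.induction_on with
  | empty => intro w hw h; exact ⟨w, hw, h, by simp⟩
  | insert i s _ ih =>
    intro w hw h
    obtain ⟨w', h1, h2, h3⟩ := ih w hw h
    by_cases hp : w' + D i w' = 0
    · refine ⟨w', h1, h2, ?_⟩
      intro j hj
      rcases Finset.mem_insert.1 hj with rfl | hj
      · right; exact (neg_eq_of_add_eq_zero_right hp).symm
      · exact h3 j hj
    · refine ⟨_, hp, ?_, ?_⟩
      · rw [map_add, map_add, hc a i, hc b i, h2, map_neg]; abel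
      · intro j hj
        rcases Finset.mem_insert.1 hj with rfl | hj
        · left; rw [map_add, hs]; abel
        · rw [map_add, hc j i]
          rcases h3 j hj with h | h
          · left; rw [h]
          · right; rw [h, map_neg]; abel

lemma joint_indep (D : Fin n → Module.End K V) (hc : ∀ i j v, D i (D j v) = D j (D i v)) :
    iSupIndep fun χ : Fin n → K => ⨅ i, (D i).eigenspace (χ i) := by
  refine (Module.End.independent_iInf_maxGenEigenspace_of_forall_mapsTo D ?_).mono ?_
  · intro i j φ
    exact Module.End.mapsTo_maxGenEigenspace_of_comm (LinearMap.ext fun v => hc _ _ _) φ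
  · intro χ
    exact iInf_mono fun i => Module.End.eigenspace_le_maxGenEigenspace

lemma sum_finrank_le [FiniteDimensional K V] {ι : Type*} [Fintype ι] (E : ι → Submodule K V) (h : iSupIndep E) :
    ∑ i, Module.finrank K (E i) ≤ Module.finrank K V := by
  classical
  rw [← Module.finrank_directSum]
  exact LinearMap.finrank_le_finrank_of_injective (f := DirectSum.coeLinearMap E)
    h.dfinsupp_lsum_injective

/-- all involutions act in the same way -/
lemma invol_eq [FiniteDimensional K V] (h2 : IsUnit (2 : R)) (h3 : IsUnit (3 : R)) (hK : (2 : K) ≠ 0)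
    (ρ : Γ →* Module.End K V) (Q : Equiv.Perm (Fin n) → Module.End K V)
    (hQ : ∀ σ v, Q σ v = 0 → v = 0) (hQρ : ∀ σ (g : Γ) v, Q σ (ρ g v) = ρ (g ∘ σ) (Q σ v))
    (hV : Module.finrank K V < 2 * n) (a b : Fin n) : ρ (inv1 a) = ρ (inv1 b) := by
  by_contra hne
  have hcom : ∀ i (g : Γ) v, ρ (inv1 i) (ρ g v) = ρ g (ρ (inv1 i) v) := by
    intro i g v
    rw [← Module.End.mul_apply, ← Module.End.mul_apply, ← map_mul, ← map_mul, inv1_comm]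
  have hsq : ∀ i v, ρ (inv1 i) (ρ (inv1 i) v) = v := by
    intro i v
    rw [← Module.End.mul_apply, ← map_mul, inv1_sq, map_one, Module.End.one_apply]
  obtain ⟨v, hv⟩ : ∃ v, ρ (inv1 a) v ≠ ρ (inv1 b) v := by
    by_contra hc
    push Not at hc
    exact hne (LinearMap.ext hc)
  obtain ⟨w, hw0, hwab, hw⟩ := exists_joint (fun i => ρ (inv1 i)) (fun i j v => hcom i _ v) hsq a b
    Finset.univ (ρ (inv1 a) v - ρ (inv1 b) v) (sub_ne_zero.2 hv) (by
      rw [map_sub, map_sub, hsq, hsq, hcom a]; abel)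
  have hnn : ∀ x : V, x = -x → x = 0 := by
    intro x hx
    have : (2 : K) • x = 0 := by rw [two_smul]; nth_rw 1 [hx]; simp
    exact (smul_eq_zero.1 this).resolve_left hK
  have hw' : ∀ i, ∃ c : K, (c = 1 ∨ c = -1) ∧ ρ (inv1 i) w = c • w := by
    intro i
    rcases hw i (Finset.mem_univ _) with h | h
    · exact ⟨1, Or.inl rfl, by simpa using h⟩
    · exact ⟨-1, Or.inr rfl, by simpa using h⟩
  choose χ hχ hχw using hw'
  have h11 : (1 : K) ≠ -1 := by
    intro h; apply hK; linear_combination h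
  obtain ⟨s, t, hs, ht⟩ : ∃ s t, χ s = -1 ∧ χ t = 1 := by
    have : χ a = - χ b := by
      simp only [hχw] at hwab
      rw [← neg_smul] at hwab
      exact smul_left_injective K hw0 hwab
    rcases hχ a with h | h
    · exact ⟨b, a, by rw [h] at this; linear_combination this, h⟩
    · exact ⟨a, b, h, by rw [h] at this; linear_combination this⟩
  have hst : s ≠ t := by rintro rfl; rw [hs] at ht; exact h11 ht.symm
  classical
  let f : Fin n → Equiv.Perm (Fin n) := fun i =>
    if i = s then 1 else if χ i = -1 then Equiv.swap i t else Equiv.swap s i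
  let ξ : Fin n → Fin n → K := fun i => χ ∘ f i
  have hinj : Function.Injective ξ := by
    intro i k hik
    have e1 := congrFun hik s
    have e2 := congrFun hik i
    have e3 := congrFun hik k
    have hi := hχ i
    have hk := hχ k
    simp only [ξ, f, Function.comp] at e1 e2 e3
    by_contra hne
    by_cases his : i = s
    · subst his
      have : k ≠ i := fun h => hne h.symm
      by_cases hk1 : χ k = -1
      · simp [hk1, this, ht] at e3; exact h11 e3.symm
      · simp [hk1, this, hs] at e1; grind
    · by_cases hks : k = s
      · subst hks
        by_cases hi1 : χ i = -1
        · simp [hi1, his, ht] at e2; exact h11 e2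
        · simp [hi1, his, hs] at e1 <;> grind
      · have hsi : s ≠ i := Ne.symm his
        have hsk : s ≠ k := Ne.symm hks
        by_cases hi1 : χ i = -1 <;> by_cases hk1 : χ k = -1
        · have hit : i ≠ t := by rintro rfl; exact h11 (ht.symm.trans hi1)
          simp [hi1, hk1, his, hks, ht, Equiv.swap_apply_of_ne_of_ne hne hit] at e2; exact h11 e2
        · simp [hi1, hk1, his, hks, hs, Equiv.swap_apply_of_ne_of_ne hsi hst] at e1 <;> grind
        · simp [hi1, hk1, his, hks, hs, Equiv.swap_apply_of_ne_of_ne hsk hst] at e1 <;> grind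
        · simp [hi1, hk1, his, hks, hs, Equiv.swap_apply_of_ne_of_ne his hne] at e2 <;> grind
  let E : Fin n → Submodule K V := fun k => ⨅ i, (ρ (inv1 i)).eigenspace (ξ k i)
  have hmem : ∀ k v, v ∈ E k ↔ ∀ i, ρ (inv1 i) v = ξ k i • v := by
    intro k v
    simp [E, Submodule.mem_iInf]
  have hE : iSupIndep E :=
    (joint_indep (fun i => ρ (inv1 i)) (fun i j v => hcom i _ v)).comp hinj
  have h2E : ∀ k, 2 ≤ Module.finrank K (E k) := by
    intro k
    have hinv : ∀ g, ∀ v ∈ E k, ρ g v ∈ E k := by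
      intro g v hv
      rw [hmem] at hv ⊢
      intro i
      rw [hcom, hv, map_smul]
    have hev := even_finrank h2 h3 hK ρ (E k) hinv ((f k).symm s) (by
      intro v hv
      rw [(hmem k v).1 hv]
      simp [ξ, hs])
    have hne : E k ≠ ⊥ := by
      rw [Submodule.ne_bot_iff]
      refine ⟨Q (f k) w, ?_, fun h => hw0 (hQ _ _ h)⟩
      rw [hmem]
      intro i
      have : (inv1 i : Γ) = inv1 (f k i) ∘ f k := by
        funext j
        by_cases h : j = i
        · subst h; simp [inv1]
        · simp [inv1, h]
      rw [this, ← hQρ, hχw, map_smul]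
      rfl
    have hpos : 0 < Module.finrank K (E k) := by
      have := Submodule.nontrivial_iff_ne_bot.2 hne
      exact Module.finrank_pos
    obtain ⟨m, hm⟩ := hev
    omega
  have h1 := sum_finrank_le E hE
  have h4 : ∑ k : Fin n, 2 ≤ ∑ k, Module.finrank K (E k) := Finset.sum_le_sum fun k _ => h2E k
  simp at h4
  omega

/-- small case -/
lemma invol_one [FiniteDimensional K V] (h2 : IsUnit (2 : R)) (h3 : IsUnit (3 : R)) (hK : (2 : K) ≠ 0)
    (ρ : Γ →* Module.End K V) (hV : Module.finrank K V < 4) (a b : Fin n) (hab : a ≠ b)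
    (he : ρ (inv1 a) = ρ (inv1 b)) : ρ (inv1 a) = 1 := by
  by_contra hne
  have hcom : ∀ i (g : Γ) v, ρ (inv1 i) (ρ g v) = ρ g (ρ (inv1 i) v) := by
    intro i g v
    rw [← Module.End.mul_apply, ← Module.End.mul_apply, ← map_mul, ← map_mul, inv1_comm]
  have hsq : ∀ i v, ρ (inv1 i) (ρ (inv1 i) v) = v := by
    intro i v
    rw [← Module.End.mul_apply, ← map_mul, inv1_sq, map_one, Module.End.one_apply]
  obtain ⟨v, hv⟩ : ∃ v, v ≠ ρ (inv1 a) v := by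
    by_contra hc
    push Not at hc
    exact hne (LinearMap.ext fun v => (hc v).symm)
  let W : Submodule K V := (ρ (inv1 a)).eigenspace (-1)
  have hmem : ∀ v, v ∈ W ↔ ρ (inv1 a) v = -v := by
    intro v; simp [W]
  have hinv : ∀ g, ∀ v ∈ W, ρ g v ∈ W := by
    intro g v hv
    rw [hmem] at hv ⊢
    rw [hcom, hv, map_neg]
  have hev := even_finrank h2 h3 hK ρ W hinv a fun v hv => (hmem v).1 hv
  have hWne : W ≠ ⊥ := by
    rw [Submodule.ne_bot_iff]
    refine ⟨v - ρ (inv1 a) v, ?_, sub_ne_zero.2 hv⟩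
    rw [hmem, map_sub, hsq]; abel
  have hnt : Nontrivial W := Submodule.nontrivial_iff_ne_bot.2 hWne
  have hpos : 0 < Module.finrank K W := Module.finrank_pos
  have hle : Module.finrank K W ≤ Module.finrank K V := Submodule.finrank_le W
  have hW2 : Module.finrank K W = 2 := by
    obtain ⟨m, hm⟩ := hev
    omega
  let f : Fin n → SpecialLinearGroup (Fin 2) R →* Module.End K W := fun i =>
    (resRep ρ W hinv).comp (MonoidHom.mulSingle (fun _ : Fin n => SpecialLinearGroup (Fin 2) R) i)
  have hf : ∀ i, (i = a ∨ i = b) → f i (-1) ≠ 1 := by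
    intro i hi h
    obtain ⟨⟨w, hw⟩, hw0⟩ := exists_ne (0 : W)
    have h1 := congrArg Subtype.val (LinearMap.congr_fun h ⟨w, hw⟩)
    have h4 : ρ (inv1 i) w = w := h1
    have h5 : ρ (inv1 i) w = -w := by
      rcases hi with rfl | rfl
      · exact (hmem w).1 hw
      · rw [← he]; exact (hmem w).1 hw
    rw [h4] at h5
    have : (2 : K) • w = 0 := by rw [two_smul]; nth_rw 1 [h5]; simp
    have := (smul_eq_zero.1 this).resolve_left hK
    exact hw0 (Subtype.ext this)
  have hcomm : ∀ x y, f a x * f b y = f b y * f a x := by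
    intro x y
    simp only [f, MonoidHom.comp_apply, ← map_mul]
    congr 1
    exact Pi.mulSingle_commute (f := fun _ : Fin n => SpecialLinearGroup (Fin 2) R) hab x y
  by_cases hA : ∀ x y, f a x * f a y = f a y * f a x
  · exact hf a (Or.inl rfl) (sl2_comm h2 h3 _ hA)
  · push Not at hA
    obtain ⟨x, y, hxy⟩ := hA
    refine hf b (Or.inr rfl) (sl2_comm h2 h3 _ fun z z' => ?_)
    exact two_by_two' hW2 _ _ _ _ hxy (hcomm _ _) (hcomm _ _)

end Rep

section Final

variable {n : ℕ} {R : Type*} [CommRing R]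

/-- the product of `SL₂`'s inside `Sp` -/
def Psi : (Fin n → SpecialLinearGroup (Fin 2) R) →* Sp n R where
  toFun g := ⟨fromBlocks (diagonal fun j => (g j).1 0 0) (diagonal fun j => (g j).1 0 1)
      (diagonal fun j => (g j).1 1 0) (diagonal fun j => (g j).1 1 1), by
    have hdet : ∀ j, (g j).1 0 0 * (g j).1 1 1 - (g j).1 0 1 * (g j).1 1 0 = 1 := by
      intro j
      rw [← Matrix.det_fin_two]; exact (g j).2
    rw [mem_symp_iff]
    intro x y
    have hx : x = Sum.elim (x ∘ Sum.inl) (x ∘ Sum.inr) := by ext (i | i) <;> rfl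
    have hy : y = Sum.elim (y ∘ Sum.inl) (y ∘ Sum.inr) := by ext (i | i) <;> rfl
    rw [hx, hy, fromBlocks_mulVec, fromBlocks_mulVec, om_eq, om_eq]
    refine Finset.sum_congr rfl fun i _ => ?_
    simp [mulVec_diagonal]
    linear_combination (x (Sum.inr i) * y (Sum.inl i) - x (Sum.inl i) * y (Sum.inr i)) * hdet i⟩
  map_one' := by
    apply Subtype.ext
    simp
  map_mul' g h := by
    apply Subtype.ext
    simp [fromBlocks_multiply, Matrix.mul_apply, Fin.sum_univ_two]

lemma ac_Psi (g : Fin n → SpecialLinearGroup (Fin 2) R) (x) :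
    ac (Psi g) x = Sum.elim
      (fun i => (g i).1 0 0 * x (Sum.inl i) + (g i).1 0 1 * x (Sum.inr i))
      (fun i => (g i).1 1 0 * x (Sum.inl i) + (g i).1 1 1 * x (Sum.inr i)) := by
  have hx : x = Sum.elim (x ∘ Sum.inl) (x ∘ Sum.inr) := by ext (i | i) <;> rfl
  show fromBlocks _ _ _ _ *ᵥ x = _
  rw [hx, fromBlocks_mulVec]
  ext (i | i) <;> simp [mulVec_diagonal]

/-- permutations inside `Sp` -/
def pm (σ : Equiv.Perm (Fin n)) : Sp n R :=
  ⟨(1 : Matrix (Fin n ⊕ Fin n) (Fin n ⊕ Fin n) R).submatrix (Sum.map σ σ) id, by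
    rw [mem_symp_iff]
    intro x y
    have key : ∀ x : Fin n ⊕ Fin n → R, (1 : Matrix (Fin n ⊕ Fin n) (Fin n ⊕ Fin n) R).submatrix
        (Sum.map σ σ) id *ᵥ x = x ∘ Sum.map σ σ := by
      intro x; ext i
      simp [mulVec, dotProduct, Matrix.one_apply]
    rw [key, key, om_eq, om_eq]
    simp only [Function.comp, Sum.map_inl, Sum.map_inr]
    exact Equiv.sum_comp σ fun i => x (Sum.inr i) * y (Sum.inl i) - x (Sum.inl i) * y (Sum.inr i)⟩

lemma ac_pm (σ : Equiv.Perm (Fin n)) (x : Fin n ⊕ Fin n → R) : ac (pm σ) x = x ∘ Sum.map σ σ := by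
  ext i
  simp [ac, pm, mulVec, dotProduct, Matrix.one_apply]

lemma pm_Psi (σ : Equiv.Perm (Fin n)) (g : Fin n → SpecialLinearGroup (Fin 2) R) :
    pm σ * Psi g = Psi (g ∘ σ) * pm σ := by
  apply ac_ext
  intro x
  rw [ac_mul, ac_mul, ac_pm, ac_pm, ac_Psi, ac_Psi]
  ext (i | i) <;> simp

lemma main_abstract [IsLocalRing R] (h2 : IsUnit (2 : R)) (h3 : IsUnit (3 : R)) {K : Type*} [Field K]
    (hK : (2 : K) ≠ 0) {N : ℕ} (hn : 1 < n) (hN : N < 2 * n) (φ : Sp n R →* GL (Fin N) K) : φ = 1 := by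
  let ρ0 : Sp n R →* Module.End K (Fin N → K) :=
    ((Matrix.toLinAlgEquiv' : Matrix (Fin N) (Fin N) K ≃ₐ[K] _) : Matrix (Fin N) (Fin N) K →*
      Module.End K (Fin N → K)).comp ((Units.coeHom _).comp φ)
  have hρ0 : ∀ g, ρ0 g = 1 → φ g = 1 := by
    intro g hg
    apply Units.ext
    apply (Matrix.toLinAlgEquiv' : Matrix (Fin N) (Fin N) K ≃ₐ[K] _).injective
    rw [Units.val_one, map_one]
    exact hg
  have hfr : Module.finrank K (Fin N → K) = N := by simp
  have heq := invol_eq h2 h3 hK (ρ0.comp Psi) (fun σ => ρ0 (pm σ)) (by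
      intro σ v hv
      have : ρ0 ((pm σ)⁻¹ * pm σ) v = 0 := by rw [map_mul, Module.End.mul_apply, hv, map_zero]
      simpa using this) (by
      intro σ g v
      simp only [MonoidHom.comp_apply]
      rw [← Module.End.mul_apply, ← Module.End.mul_apply, ← map_mul, ← map_mul, pm_Psi])
    (by rw [hfr]; exact hN)
  rcases Nat.lt_or_ge 2 n with hn2 | hn2
  · let a : Fin n := ⟨0, by omega⟩
    let b : Fin n := ⟨1, by omega⟩
    let c : Fin n := ⟨2, by omega⟩
    have hab : a ≠ b := by simp [a, b]
    have hac : a ≠ c := by simp [a, c]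
    have hbc : b ≠ c := by simp [b, c]
    refine kernel_top φ h2 h3 hac (Psi (inv1 a * inv1 b)) ?_ ?_ ?_
    · apply hρ0
      have h1 : ρ0 (Psi (inv1 a)) = ρ0 (Psi (inv1 b)) := heq a b
      rw [map_mul, map_mul, h1, ← map_mul, ← map_mul, inv1_sq, map_one, map_one]
    · rw [ac_Psi]
      ext (i | i)
      · by_cases h : i = a
        · subst h; simp [inv1, be, hab]
        · simp [be, h]
      · by_cases h : i = a
        · subst h; simp [inv1, be, hab]
        · by_cases h' : i = b
          · subst h'; simp [inv1, be, h]
          · simp [inv1, be, h, h']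
    · rw [ac_Psi]
      ext (i | i)
      · by_cases h : i = c
        · subst h; simp [inv1, be, hac.symm, hbc.symm]
        · simp [be, h]
      · by_cases h : i = c
        · subst h; simp [inv1, be, hac.symm, hbc.symm]
        · simp [be, h]
  · let a : Fin n := ⟨0, by omega⟩
    let b : Fin n := ⟨1, by omega⟩
    have hab : a ≠ b := by simp [a, b]
    refine kernel_top φ h2 h3 hab (Psi (inv1 a)) ?_ ?_ ?_
    · apply hρ0
      exact invol_one h2 h3 hK (ρ0.comp Psi) (by rw [hfr]; omega) a b hab (heq a b)
    · rw [ac_Psi]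
      ext (i | i)
      · by_cases h : i = a
        · subst h; simp [inv1, be]
        · simp [be, h]
      · by_cases h : i = a
        · subst h; simp [inv1, be]
        · simp [be, h]
    · rw [ac_Psi]
      ext (i | i)
      · by_cases h : i = b
        · subst h; simp [inv1, be, hab.symm]
        · simp [be, h]
      · by_cases h : i = b
        · subst h; simp [inv1, be, hab.symm]
        · simp [be, h]

end Final

/-- **Wong, Theorem 4(b) for `Sp_{2n}`.**  For integers `n, N > 1` with `N < 2n` there is a
constant `c(n,N) > 0` such that for every prime `l > c(n,N)` and any rings of integers
`𝒪, 𝒪'` of finite extensions `K, K'` of `ℚ_l` (realized as the integral closure of `ℤ_l`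
in the extension), there is no nontrivial abstract (not assumed continuous) group
homomorphism `φ : Sp_{2n}(𝒪') → GL_N(𝒪)`. -/
theorem no_abstract_hom_Sp (n N : ℕ) (hn : 1 < n) (hN : 1 < N) (hNn : N < 2 * n) :
    ∃ c : ℕ, 0 < c ∧
      ∀ (l : ℕ) [Fact (Nat.Prime l)], c < l →
      ∀ (K K' : Type) [Field K] [Field K']
        [Algebra ℚ_[l] K] [Algebra ℚ_[l] K']
        [FiniteDimensional ℚ_[l] K] [FiniteDimensional ℚ_[l] K']
        [Algebra ℤ_[l] K] [Algebra ℤ_[l] K']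
        [IsScalarTower ℤ_[l] ℚ_[l] K] [IsScalarTower ℤ_[l] ℚ_[l] K'],
      ∀ φ : Matrix.symplecticGroup (Fin n) ↥(integralClosure ℤ_[l] K') →*
              GL (Fin N) ↥(integralClosure ℤ_[l] K),
        φ = 1 := by
  refine ⟨3, by norm_num, ?_⟩
  intro l hl hlt K K' _ _ _ _ _ _ _ _ _ _ φ
  have hlp : Nat.Prime l := hl.out
  haveI := aux_isLocalRing l K'
  have h2 : IsUnit (2 : integralClosure ℤ_[l] K') := by
    exact_mod_cast aux_isUnit l K' 2 ((Nat.coprime_primes Nat.prime_two hlp).2 (by omega))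
  have h3 : IsUnit (3 : integralClosure ℤ_[l] K') := by
    exact_mod_cast aux_isUnit l K' 3 ((Nat.coprime_primes Nat.prime_three hlp).2 (by omega))
  haveI : CharZero K := charZero_of_injective_algebraMap (algebraMap ℚ_[l] K).injective
  let ι : integralClosure ℤ_[l] K →+* K := algebraMap (integralClosure ℤ_[l] K) K
  have hι : Function.Injective ι := Subtype.val_injective
  have h := main_abstract h2 h3 (K := K) two_ne_zero hn hNn
    ((Matrix.GeneralLinearGroup.map ι).comp φ)
  ext g i j
  have hg := congrArg (fun M : GL (Fin N) K => M.1 i j) (DFunLike.congr_fun h g)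
  simp only [MonoidHom.comp_apply, MonoidHom.one_apply] at hg ⊢
  have hg' : ι ((φ g).1 i j) = (1 : Matrix (Fin N) (Fin N) K) i j := hg
  have h1 : ι ((1 : Matrix (Fin N) (Fin N) (integralClosure ℤ_[l] K)) i j) =
      (1 : Matrix (Fin N) (Fin N) K) i j := by
    by_cases hij : i = j
    · subst hij; simp
    · simp [hij]
  exact congrArg Subtype.val (hι (hg'.trans h1.symm))
end

section
/- For any integers n, N > 1 there exists a constant c(n, N) > 0 such that for every prime l > c(n, N) and any two rings of integers 𝒪 and 𝒪' of finite extensions of ℚ_l, every abstract (not assumed continuous) group homomorphism φ: GL_n(𝒪') → GL_N(𝒪) is continuous with respect to the l-adic topologies. -/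
open Matrix

/-- Reduction of `GL (Fin N) O` modulo an ideal `I`, i.e. the homomorphism
`GL_N(O) → GL_N(O/I)` induced by the quotient map. -/
noncomputable def glReduction {O : Type*} [CommRing O] (N : ℕ) (I : Ideal O) :
    GL (Fin N) O →* GL (Fin N) (O ⧸ I) :=
  Matrix.GeneralLinearGroup.map (Ideal.Quotient.mk I)

/-- The level-`i` principal congruence subgroup `G_i` of `GL_N(O)`: the kernel of the
reduction map `GL_N(O) → GL_N(O/λ^i)`. -/
noncomputable def glCongruence {O : Type*} [CommRing O] (N : ℕ) (I : Ideal O) (i : ℕ) :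
    Subgroup (GL (Fin N) O) :=
  (glReduction N (I ^ i)).ker

lemma aux_root {S : Type*} [CommRing S] (I : Ideal S) [HenselianRing S I] (b : S) (hb : b ∈ I)
    (k : ℕ) : ∃ x : S, x ^ (k + 2) = 1 + ((k + 2 : ℕ) : S) ^ 2 * b := by
  classical
  set m : S := ((k + 2 : ℕ) : S) with hm
  let h : Polynomial S := ∑ j ∈ Finset.range (k + 1),
    Polynomial.C (((k + 2).choose j : S) * (m * b) ^ (k - j)) * Polynomial.X ^ j
  let Q : Polynomial S := Polynomial.X ^ (k + 1 + 1) - (Polynomial.X ^ (k + 1) + Polynomial.C b * h)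
  have hdeg : h.degree ≤ (k + 1 : ℕ) := by
    refine (Polynomial.degree_sum_le _ _).trans (Finset.sup_le fun j hj => ?_)
    refine (Polynomial.degree_C_mul_X_pow_le _ _).trans ?_
    exact_mod_cast (Finset.mem_range.1 hj).le
  have hQ : Q.Monic := by
    refine Polynomial.monic_X_pow_sub (lt_of_le_of_lt (b := ((k + 1 : ℕ) : WithBot ℕ)) ?_ (by exact_mod_cast Nat.lt_succ_self _))
    refine (Polynomial.degree_add_le _ _).trans (max_le (Polynomial.degree_X_pow_le _) ?_)
    rw [Polynomial.C_mul']
    exact (Polynomial.degree_smul_le _ _).trans hdeg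
  have hh : ∀ v : S, (v + m * b) ^ (k + 2) =
      v ^ (k + 2) + m ^ 2 * b * v ^ (k + 1) + m ^ 2 * b ^ 2 * h.eval v := by
    intro v
    have e : (m * b) ^ 2 * h.eval v = ∑ j ∈ Finset.range (k + 1),
        v ^ j * (m * b) ^ (k + 2 - j) * ((k + 2).choose j : S) := by
      simp only [h, Polynomial.eval_finsetSum, Finset.mul_sum]
      refine Finset.sum_congr rfl fun j hj => ?_
      have : k + 2 - j = (k - j) + 2 := by have := Finset.mem_range.1 hj; omega
      rw [this]; simp; ring
    rw [add_pow, Finset.sum_range_succ, Finset.sum_range_succ, ← e]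
    have h1 : k + 2 - (k + 1) = 1 := by omega
    have h2 : (k + 2).choose (k + 1) = k + 2 := by simp
    rw [h1, h2]; simp only [← hm, Nat.sub_self, Nat.choose_self]
    push_cast; ring
  obtain ⟨v, hv, hv1⟩ := HenselianRing.is_henselian (I := I) Q hQ 1
    (by simp [Q]; exact I.mul_mem_right _ hb)
    (by
      have : Ideal.Quotient.mk I b = 0 := Ideal.Quotient.eq_zero_iff_mem.2 hb
      simp [Q, this])
  have hu : IsUnit v := by
    have := HenselianRing.jac (I := I) hv1
    rw [Ideal.mem_jacobson_bot] at this
    simpa using this 1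
  obtain ⟨u, rfl⟩ := hu
  have hv' : (u : S) ^ (k + 2) = u ^ (k + 1) + b * h.eval (u : S) := by
    have := hv
    simp only [Q, Polynomial.IsRoot, Polynomial.eval_sub, Polynomial.eval_add, Polynomial.eval_mul, Polynomial.eval_pow, Polynomial.eval_X, Polynomial.eval_C] at this
    exact sub_eq_zero.1 this
  refine ⟨(u + m * b) * (↑u⁻¹ : S), ?_⟩
  have key : ((u : S) + m * b) ^ (k + 2) = (1 + m ^ 2 * b) * u ^ (k + 2) := by
    rw [hh]; linear_combination (-m ^ 2 * b) * hv'
  rw [mul_pow, key, mul_assoc, ← mul_pow, Units.mul_inv, one_pow, mul_one]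

lemma aux_complete {R M : Type} [CommRing R] [IsNoetherianRing R] (I : Ideal R) [IsAdicComplete I R]
    [AddCommGroup M] [Module R M] [Module.Finite R M] : IsAdicComplete I M := by
  rw [← AdicCompletion.of_bijective_iff]
  let e : M ≃ₗ[R] TensorProduct R (AdicCompletion I R) M :=
    (TensorProduct.lid R M).symm ≪≫ₗ
      TensorProduct.congr (LinearEquiv.ofBijective (AdicCompletion.of I R) (AdicCompletion.of_bijective_iff.2 inferInstance)) (LinearEquiv.refl R M)
  have : (AdicCompletion.of I M : M → _) = AdicCompletion.ofTensorProduct I M ∘ e := by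
    ext1 x
    simp only [e, Function.comp, LinearEquiv.trans_apply, TensorProduct.lid_symm_apply, TensorProduct.congr_tmul, LinearEquiv.ofBijective_apply, LinearEquiv.refl_apply, AdicCompletion.ofTensorProduct_tmul]
    have : AdicCompletion.of I R 1 = 1 := rfl
    rw [this, one_smul]
  rw [this]
  exact (AdicCompletion.ofTensorProduct_bijective_of_finite_of_isNoetherian I M).comp e.bijective

lemma aux_alg {l : ℕ} [Fact l.Prime] {A : Type*} [Ring A] [Algebra ℤ_[l] A] [Module.Finite ℤ_[l] A]
    (B : A) (k : ℕ) : ∃ x : A, x ^ (k + 2) = 1 + ((k + 2 : ℕ) : A) ^ 2 * ((l : A) * B) := by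
  obtain ⟨P, hP, hPB⟩ := IsIntegral.of_finite ℤ_[l] B
  have : Module.Finite ℤ_[l] (AdjoinRoot P) := hP.finite_adjoinRoot
  let I : Ideal (AdjoinRoot P) := (IsLocalRing.maximalIdeal ℤ_[l]).map (algebraMap _ _)
  have : IsAdicComplete I (AdjoinRoot P) := by
    rw [IsAdicComplete.map_algebraMap_iff]
    exact aux_complete _
  have hl : (l : AdjoinRoot P) * AdjoinRoot.root P ∈ I := by
    refine I.mul_mem_right _ ?_
    have : (l : ℤ_[l]) ∈ IsLocalRing.maximalIdeal ℤ_[l] := by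
      rw [PadicInt.maximalIdeal_eq_span_p]; exact Ideal.mem_span_singleton_self _
    have h2 := Ideal.mem_map_of_mem (algebraMap ℤ_[l] (AdjoinRoot P)) this
    rwa [map_natCast] at h2
  obtain ⟨x, hx⟩ := aux_root I _ hl k
  let f : AdjoinRoot P →+* A := Ideal.Quotient.lift _ (Polynomial.aeval B : Polynomial ℤ_[l] →ₐ[ℤ_[l]] A).toRingHom (by
    intro a ha
    obtain ⟨c, rfl⟩ := Ideal.mem_span_singleton.1 ha
    have : Polynomial.aeval B P = 0 := hPB
    simp [this])
  have hf : f (AdjoinRoot.root P) = B := by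
    have : f (AdjoinRoot.root P) = Polynomial.aeval B (Polynomial.X : Polynomial ℤ_[l]) := rfl
    simpa using this
  refine ⟨f x, ?_⟩
  rw [← map_pow, hx]
  rw [map_add, map_mul, map_mul, map_pow, map_natCast, map_natCast, map_one, hf]

lemma aux_fin {l : ℕ} [Fact l.Prime] {A : Type*} [CommRing A] [Algebra ℤ_[l] A] [Module.Finite ℤ_[l] A]
    (J : Ideal A) (m : ℕ) (hm : m ≠ 0) (h : (m : A) ∈ J) : Finite (A ⧸ J) := by
  let J0 : Ideal ℤ_[l] := Ideal.span {(m : ℤ_[l])}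
  have hm' : (m : ℤ_[l]) ≠ 0 := by exact_mod_cast hm
  have : Finite (ℤ_[l] ⧸ J0) := by
    have e : J0 = Ideal.span {(l : ℤ_[l]) ^ (m : ℤ_[l]).valuation} := by
      rw [Ideal.span_singleton_eq_span_singleton]
      exact ⟨(PadicInt.unitCoeff hm')⁻¹, by
        rw [Units.mul_inv_eq_iff_eq_mul, mul_comm]; exact PadicInt.unitCoeff_spec hm'⟩
    rw [e, ← PadicInt.ker_toZModPow]
    have : NeZero (l ^ (m : ℤ_[l]).valuation) := ⟨pow_ne_zero _ (Fact.out : l.Prime).ne_zero⟩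
    exact Finite.of_injective _ (RingHom.kerLift_injective (PadicInt.toZModPow _))
  have hJ : J0 ≤ J.comap (algebraMap ℤ_[l] A) := by
    rw [Ideal.span_le]; simpa using h
  let _ : Algebra (ℤ_[l] ⧸ J0) (A ⧸ J) := (Ideal.quotientMap J (algebraMap ℤ_[l] A) hJ).toAlgebra
  have : IsScalarTower ℤ_[l] (ℤ_[l] ⧸ J0) (A ⧸ J) := IsScalarTower.of_algebraMap_eq fun x => rfl
  have : Module.Finite (ℤ_[l] ⧸ J0) (A ⧸ J) := Module.Finite.of_restrictScalars_finite ℤ_[l] _ _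
  exact Module.finite_of_finite (ℤ_[l] ⧸ J0)

lemma aux_int {l : ℕ} [Fact l.Prime] (K : Type) [Field K] [Algebra ℚ_[l] K] [FiniteDimensional ℚ_[l] K]
    [Algebra ℤ_[l] K] [IsScalarTower ℤ_[l] ℚ_[l] K] : Module.Finite ℤ_[l] (integralClosure ℤ_[l] K) :=
  IsIntegralClosure.finite ℤ_[l] ℚ_[l] K _

lemma aux_mem {l : ℕ} [Fact l.Prime] (A : Type*) [CommRing A] [IsLocalRing A] [Algebra ℤ_[l] A]
    [Module.Finite ℤ_[l] A] [FaithfulSMul ℤ_[l] A] : (l : A) ∈ IsLocalRing.maximalIdeal A := by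
  rw [IsLocalRing.mem_maximalIdeal, mem_nonunits_iff]
  intro h
  have : Algebra.IsIntegral ℤ_[l] A := inferInstance
  have h2 : IsUnit (algebraMap ℤ_[l] A l) := by simpa using h
  have h3 : IsUnit (l : ℤ_[l]) := by
    have := Algebra.IsIntegral.isLocalHom ℤ_[l] A
    exact this.map_nonunit _ h2
  exact PadicInt.p_nonunit h3

theorem aux_main {l : ℕ} [Fact l.Prime] {A A' : Type*} [CommRing A] [IsLocalRing A] [Algebra ℤ_[l] A]
    [Module.Finite ℤ_[l] A] [FaithfulSMul ℤ_[l] A] [CommRing A'] [IsLocalRing A'] [Algebra ℤ_[l] A']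
    [Module.Finite ℤ_[l] A'] (n N : ℕ) (φ : GL (Fin n) A' →* GL (Fin N) A) (i : ℕ) : ∃ j : ℕ,
    ∀ g : GL (Fin n) A', Matrix.GeneralLinearGroup.map (Ideal.Quotient.mk (IsLocalRing.maximalIdeal A' ^ j)) g = 1 →
      Matrix.GeneralLinearGroup.map (Ideal.Quotient.mk (IsLocalRing.maximalIdeal A ^ i)) (φ g) = 1 := by
  have hl := (Fact.out : l.Prime).ne_zero
  have : Finite (A ⧸ IsLocalRing.maximalIdeal A ^ i) :=
    aux_fin (l := l) _ (l ^ i) (pow_ne_zero _ hl) (by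
      push_cast; exact Ideal.pow_mem_pow (aux_mem A) i)
  have : Finite (GL (Fin N) (A ⧸ IsLocalRing.maximalIdeal A ^ i)) :=
    Finite.of_injective (fun g => g.val) Units.val_injective
  obtain ⟨k, hk⟩ : ∃ k, Nat.card (GL (Fin N) (A ⧸ IsLocalRing.maximalIdeal A ^ i)) * 2 = k + 2 :=
    Nat.exists_eq_add_of_le' (by have := Nat.card_pos (α := GL (Fin N) (A ⧸ IsLocalRing.maximalIdeal A ^ i)); omega)
  let d : A' := ((k + 2 : ℕ) : A') ^ 2 * l
  have : Finite (A' ⧸ Ideal.span {d}) := aux_fin (l := l) _ ((k + 2) ^ 2 * l) (by positivity) (by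
    have : (((k + 2) ^ 2 * l : ℕ) : A') = d := by simp [d]
    rw [this]; exact Ideal.mem_span_singleton_self _)
  obtain ⟨j, hj⟩ := IsLocalRing.exists_maximalIdeal_pow_le_of_isArtinianRing_quotient (Ideal.span {d})
  refine ⟨j, fun g hg => ?_⟩
  have hB : ∀ a b, ∃ c, (g : Matrix (Fin n) (Fin n) A') a b = (1 : Matrix (Fin n) (Fin n) A') a b + d * c := by
    intro a b
    have h1 := congrArg (fun M : GL (Fin n) (A' ⧸ IsLocalRing.maximalIdeal A' ^ j) => M.val a b) hg
    have h2 : Ideal.Quotient.mk (IsLocalRing.maximalIdeal A' ^ j) ((g : Matrix (Fin n) (Fin n) A') a b)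
        = Ideal.Quotient.mk (IsLocalRing.maximalIdeal A' ^ j) ((1 : Matrix (Fin n) (Fin n) A') a b) := by
      refine h1.trans ?_
      simp only [Units.val_one, Matrix.one_apply]
      split_ifs <;> simp
    obtain ⟨c, hc⟩ := Ideal.mem_span_singleton.1 (hj (Ideal.Quotient.eq.1 h2))
    exact ⟨c, by rw [← hc]; ring⟩
  choose B hB using hB
  have : Module.Finite ℤ_[l] (Matrix (Fin n) (Fin n) A') := Module.Finite.trans A' _
  obtain ⟨x, hx⟩ := aux_alg (l := l) (Matrix.of B) k
  have hgx : x ^ (k + 2) = g.val := by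
    rw [hx]
    ext a b
    rw [hB]
    have : ((k + 2 : ℕ) : Matrix (Fin n) (Fin n) A') ^ 2 * ((l : Matrix (Fin n) (Fin n) A') * Matrix.of B) = d • Matrix.of B := by
      rw [← mul_assoc]
      have : ((k + 2 : ℕ) : Matrix (Fin n) (Fin n) A') ^ 2 * (l : Matrix (Fin n) (Fin n) A') = algebraMap A' _ d := by
        rw [map_mul, map_pow, map_natCast, map_natCast]
      rw [this, Algebra.smul_def]
    rw [this]; simp
  have hu : IsUnit x := (isUnit_pow_iff (by omega : k + 2 ≠ 0)).1 (hgx ▸ g.isUnit)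
  obtain ⟨u, rfl⟩ := hu
  have : g = u ^ (k + 2) := Units.ext (by rw [← hgx]; simp)
  rw [this, map_pow, map_pow, ← hk, pow_mul, pow_card_eq_one', one_pow]

/-- **Wong, Theorem 4(a) for `GL_n` (continuity).**  For integers `n, N > 1` there is a
constant `c(n,N) > 0` such that for every prime `l > c(n,N)` and any rings of integers
`𝒪, 𝒪'` of finite extensions `K, K'` of `ℚ_l` (realized as the integral closure of `ℤ_l`
in the extension, which is a local ring), every abstract (not assumed continuous) group
homomorphism `φ : GL_n(𝒪') → GL_N(𝒪)` is continuous for the `l`-adic topologies — the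
topologies in which the principal congruence subgroups form bases of neighbourhoods of the
identity, so that continuity of the group homomorphism `φ` means exactly that for every `i`
there is a `j` with `φ(G'_j) ⊆ G_i`. -/
theorem abstract_hom_GL_continuous (n N : ℕ) (hn : 1 < n) (hN : 1 < N) :
    ∃ c : ℕ, 0 < c ∧
      ∀ (l : ℕ) [Fact (Nat.Prime l)], c < l →
      ∀ (K K' : Type) [Field K] [Field K']
        [Algebra ℚ_[l] K] [Algebra ℚ_[l] K']
        [FiniteDimensional ℚ_[l] K] [FiniteDimensional ℚ_[l] K']
        [Algebra ℤ_[l] K] [Algebra ℤ_[l] K']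
        [IsScalarTower ℤ_[l] ℚ_[l] K] [IsScalarTower ℤ_[l] ℚ_[l] K']
        [IsLocalRing ↥(integralClosure ℤ_[l] K)] [IsLocalRing ↥(integralClosure ℤ_[l] K')],
      ∀ φ : GL (Fin n) ↥(integralClosure ℤ_[l] K') →* GL (Fin N) ↥(integralClosure ℤ_[l] K),
        ∀ i : ℕ, ∃ j : ℕ,
          ∀ g, g ∈ glCongruence n (IsLocalRing.maximalIdeal ↥(integralClosure ℤ_[l] K')) j →
            φ g ∈ glCongruence N (IsLocalRing.maximalIdeal ↥(integralClosure ℤ_[l] K)) i := by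
  refine ⟨1, one_pos, ?_⟩
  intro l _ _ K K' _ _ _ _ _ _ _ _ _ _ _ _ φ i
  have := aux_int (l := l) K
  have := aux_int (l := l) K'
  have : FaithfulSMul ℤ_[l] K := by
    rw [faithfulSMul_iff_algebraMap_injective, IsScalarTower.algebraMap_eq ℤ_[l] ℚ_[l] K]
    exact (algebraMap ℚ_[l] K).injective.comp (FaithfulSMul.algebraMap_injective ℤ_[l] ℚ_[l])
  have : FaithfulSMul ℤ_[l] (integralClosure ℤ_[l] K) := by
    rw [faithfulSMul_iff_algebraMap_injective]
    intro x y hxy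
    exact FaithfulSMul.algebraMap_injective ℤ_[l] K (congrArg Subtype.val hxy)
  exact aux_main (l := l) n N φ i
end
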